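/- Lower bound for 1 − λ(z) on the closed unit disk: let (Y,μ) be a probability space and φ : Y → {1,2,3,…} measurable with μ(φ > n) = ℓ(n)n^{−β} for all n ≥ 1, where β ∈ (0,1) and ℓ is slowly varying. Suppose that for each z in the closed unit disk with z ≠ 1 and |z − 1| < r₀ there is v_z ∈ L^∞(Y,ℂ) with ∫_Y v_z dμ = 1, such that ‖v_z − 1‖_∞ → 0 as z → 1 (for every δ > 0 there is r > 0 with ‖v_z − 1‖_∞ ≤ δ whenever |z−1| < r), and define λ(z) = ∫_Y z^{φ} v_z dμ. Then there exist ε > 0 and C > 0 such that |1 − λ(e^{−u+iθ})| ≥ C ℓ(1/θ) θ^{β} for all u ∈ [0, ε) and θ ∈ (0, ε). -/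

import Mathlib

open MeasureTheory Filter Topology

/-- `l` is slowly varying: measurable, bounded above and below by positive constants on
each compact subset of `(0,∞)`, and `l (λ x)/ l x → 1` as `x → ∞` for every `λ > 0`. -/
def SlowlyVarying (l : ℝ → ℝ) : Prop :=
  Measurable l ∧
  (∀ K : Set ℝ, IsCompact K → K ⊆ Set.Ioi 0 →
    ∃ c C : ℝ, 0 < c ∧ ∀ x ∈ K, c ≤ l x ∧ l x ≤ C) ∧
  ∀ lam : ℝ, 0 < lam → Tendsto (fun x => l (lam * x) / l x) atTop (𝓝 1)

lemma SV_pos {l : ℝ → ℝ} (hl : SlowlyVarying l) {x : ℝ} (hx : 0 < x) : 0 < l x := by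
  obtain ⟨c, C, hc, h⟩ := hl.2.1 {x} isCompact_singleton (by simpa using hx)
  exact hc.trans_le (h x rfl).1

lemma uct_add (h : ℝ → ℝ) (hm : Measurable h)
    (hlim : ∀ t, Tendsto (fun x => h (x + t) - h x) atTop (𝓝 0)) (η : ℝ) (hη : 0 < η) :
    ∃ X : ℝ, ∀ x, X ≤ x → ∀ s, 0 ≤ s → s ≤ 1 → |h (x + s) - h x| ≤ 2 * η := by
  let E : ℕ → Set ℝ := fun n => {t | t ∈ Set.Icc (0:ℝ) 2 ∧ ∀ y : ℝ, (n:ℝ) ≤ y → |h (y + t) - h y| ≤ η}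
  have hmono : Monotone E := by
    intro a b hab t ht
    refine ⟨ht.1, fun y hy => ht.2 y (le_trans (by exact_mod_cast hab) hy)⟩
  have hU : ⋃ n, E n = Set.Icc (0:ℝ) 2 := by
    ext t
    simp only [Set.mem_iUnion]
    constructor
    · rintro ⟨n, hn⟩; exact hn.1
    · intro ht
      have := (Metric.tendsto_atTop.1 (hlim t)) η hη
      obtain ⟨N, hN⟩ := this
      obtain ⟨n, hn⟩ := exists_nat_ge N
      refine ⟨n, ht, fun y hy => ?_⟩
      have := hN y (hn.trans hy)
      rw [Real.dist_eq, sub_zero] at this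
      exact this.le
  have ht := tendsto_measure_iUnion_atTop (μ := (volume : Measure ℝ)) hmono
  rw [hU, Real.volume_Icc] at ht
  have hev := ht.eventually (lt_mem_nhds (a := ENNReal.ofReal (3/2)) (by
    apply (ENNReal.ofReal_lt_ofReal_iff (by norm_num)).2; norm_num))
  obtain ⟨n, hn⟩ := hev.exists
  refine ⟨n, fun x hx s hs0 hs1 => ?_⟩
  let A : ℝ → Set ℝ := fun y => {t | t ∈ Set.Icc (0:ℝ) 2 ∧ |h (y + t) - h y| ≤ η}
  have hA : ∀ y, (n:ℝ) ≤ y → ENNReal.ofReal (3/2) < volume (A y) := by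
    intro y hy
    refine lt_of_lt_of_le hn (measure_mono fun t ht => ⟨ht.1, ht.2 y hy⟩)
  have hAm : ∀ y, MeasurableSet (A y) := by
    intro y
    have : Measurable fun t => h (y + t) - h y := (hm.comp (measurable_const_add y)).sub_const _
    have h2 : Measurable fun t => |h (y + t) - h y| := by
      simpa [Real.norm_eq_abs] using this.norm
    have h3 : MeasurableSet {t | |h (y + t) - h y| ≤ η} := measurableSet_le h2 measurable_const
    exact measurableSet_Icc.inter h3
  let B : Set ℝ := (fun t => t - s) ⁻¹' (A (x + s))
  have hBm : MeasurableSet B := (measurable_id.sub_const s) (hAm _)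
  have hBv : volume B = volume (A (x+s)) := by
    simp [B, sub_eq_add_neg]
  have hne : ¬ Disjoint (A x) B := by
    intro hd
    have h1 := measure_union hd hBm (μ := (volume : Measure ℝ))
    have h2 : volume (A x ∪ B) ≤ ENNReal.ofReal 3 := by
      have : A x ∪ B ⊆ Set.Icc 0 3 := by
        rintro t (ht | ht)
        · exact ⟨ht.1.1, by linarith [ht.1.2]⟩
        · have := ht.1
          simp only [Set.mem_Icc] at this ⊢
          constructor <;> linarith [this.1, this.2]
      calc _ ≤ volume (Set.Icc (0:ℝ) 3) := measure_mono this
        _ = _ := by simp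
    have h3 : ENNReal.ofReal (3/2) + ENNReal.ofReal (3/2) < volume (A x) + volume B := by
      rw [hBv]
      exact ENNReal.add_lt_add (hA x hx) (hA (x+s) (by linarith))
    rw [← ENNReal.ofReal_add (by norm_num) (by norm_num), ← h1] at h3
    have := h3.trans_le h2
    norm_num at this
  obtain ⟨t, ht1, ht2⟩ := Set.not_disjoint_iff.1 hne
  have h1 := ht1.2
  have h2 : |h (x + s + (t - s)) - h (x + s)| ≤ η := ht2.2
  rw [show x + s + (t - s) = x + t by ring] at h2
  rw [abs_le] at *
  constructor <;> linarith [h1.1, h1.2, h2.1, h2.2]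

lemma uct_mul {l : ℝ → ℝ} (hl : SlowlyVarying l) (η : ℝ) (hη : 0 < η) :
    ∃ X : ℝ, 0 < X ∧ ∀ x, X ≤ x → ∀ y, x ≤ y → y ≤ 2 * x → |Real.log (l y) - Real.log (l x)| ≤ η := by
  obtain ⟨X, hX⟩ := uct_add (fun x => Real.log (l (Real.exp x)))
    (Real.measurable_log.comp (hl.1.comp Real.measurable_exp)) (by
      intro t
      have h1 := (hl.2.2 (Real.exp t) (Real.exp_pos t)).comp Real.tendsto_exp_atTop
      have h2 := ((Real.continuousAt_log (one_ne_zero)).tendsto).comp h1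
      rw [Real.log_one] at h2
      refine h2.congr fun x => ?_
      simp only [Function.comp]
      rw [Real.log_div (SV_pos hl (by positivity)).ne' (SV_pos hl (by positivity)).ne',
        ← Real.exp_add, add_comm t x]) (η/2) (by positivity)
  refine ⟨Real.exp X, Real.exp_pos _, fun x hx y hxy hy => ?_⟩
  have hx0 : 0 < x := (Real.exp_pos X).trans_le hx
  have hy0 : 0 < y := hx0.trans_le hxy
  have := hX (Real.log x) ((Real.le_log_iff_exp_le hx0).2 hx) (Real.log y - Real.log x)
    (sub_nonneg.2 (Real.log_le_log hx0 hxy)) (by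
      have : Real.log y ≤ Real.log (2 * x) := Real.log_le_log hy0 hy
      rw [Real.log_mul (by norm_num) hx0.ne'] at this
      linarith [Real.log_two_lt_d9])
  rw [add_sub_cancel, Real.exp_log hx0, Real.exp_log hy0] at this
  linarith

lemma floor_ratio {l : ℝ → ℝ} (hl : SlowlyVarying l) :
    Tendsto (fun x : ℝ => l (⌊x⌋₊ : ℝ) / l x) atTop (𝓝 1) := by
  have h : Tendsto (fun x : ℝ => Real.log (l (⌊x⌋₊ : ℝ)) - Real.log (l x)) atTop (𝓝 0) := by
    rw [Metric.tendsto_atTop]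
    intro η hη
    obtain ⟨X, hX0, hX⟩ := uct_mul hl (η/2) (by positivity)
    refine ⟨X + 2, fun x hx => ?_⟩
    have h1 := Nat.lt_floor_add_one x
    have h2 := Nat.floor_le (show 0 ≤ x by linarith)
    have := hX (⌊x⌋₊ : ℝ) (by linarith) x h2 (by linarith)
    rw [Real.dist_eq, sub_zero, abs_sub_comm]
    linarith
  have h2 := (Real.continuous_exp.tendsto 0).comp h
  rw [Real.exp_zero] at h2
  refine h2.congr' ?_
  filter_upwards [eventually_ge_atTop 1] with x hx
  have hp : (0:ℝ) < ⌊x⌋₊ := by exact_mod_cast Nat.floor_pos.2 hx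
  simp only [Function.comp]
  rw [Real.exp_sub, Real.exp_log (SV_pos hl hp), Real.exp_log (SV_pos hl (by linarith))]

lemma T_asymp {l T : ℝ → ℝ} (hl : SlowlyVarying l) (β : ℝ)
    (hT : ∀ x, 1 ≤ x → T x = l (⌊x⌋₊ : ℝ) * (⌊x⌋₊ : ℝ) ^ (-β)) :
    Tendsto (fun x => T x / (l x * x ^ (-β))) atTop (𝓝 1) := by
  have h1 := floor_ratio hl
  have h2 : Tendsto (fun x : ℝ => ((⌊x⌋₊ : ℝ) / x) ^ (-β)) atTop (𝓝 1) := by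
    have := (tendsto_nat_floor_div_atTop (R := ℝ)).rpow_const (p := -β) (Or.inl one_ne_zero)
    simpa using this
  have := h1.mul h2
  rw [one_mul] at this
  refine this.congr' ?_
  filter_upwards [eventually_ge_atTop 1] with x hx
  rw [hT x hx, Real.div_rpow (by positivity) (by positivity)]
  field_simp

lemma T_ratio {l T : ℝ → ℝ} (hl : SlowlyVarying l) (β : ℝ)
    (hT : ∀ x, 1 ≤ x → T x = l (⌊x⌋₊ : ℝ) * (⌊x⌋₊ : ℝ) ^ (-β)) (c : ℝ) (hc : 0 < c) :
    Tendsto (fun x => T (c * x) / T x) atTop (𝓝 (c ^ (-β))) := by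
  have h1 := T_asymp hl β hT
  have h2 := h1.comp (tendsto_id.const_mul_atTop hc)
  have h3 := hl.2.2 c hc
  have := ((h2.div h1 one_ne_zero).mul h3).mul_const (c ^ (-β))
  simp only [div_one, one_mul] at this
  refine this.congr' ?_
  filter_upwards [eventually_gt_atTop 0] with x hx
  have := SV_pos hl hx
  have := SV_pos hl (mul_pos hc hx)
  have : 0 < x ^ (-β) := by positivity
  have : 0 < c ^ (-β) := by positivity
  simp only [Function.comp, id, Pi.div_apply]
  rw [Real.mul_rpow hc.le hx.le]
  field_simp

lemma karamata (G T : ℝ → ℝ) (hTpos : ∀ x, 0 < x → 0 < T x) (hTanti : Antitone T)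
    (hG : ∀ x, 0 ≤ x → G x ≤ x) (hstep : ∀ x, 0 ≤ x → G (2 * x) ≤ G x + x * T x)
    (q X : ℝ) (hq0 : 0 < q) (hq : q < 1) (hX : 0 < X) (hd : ∀ x, X ≤ x → T x ≤ 2 * q * T (2 * x)) :
    ∃ K, 0 < K ∧ ∀ x, X ≤ x → G x ≤ K * (x * T x) := by
  have h2X := hTpos (2 * X) (by linarith)
  refine ⟨max (1 / T (2*X)) (q / (1 - q)), lt_max_of_lt_left (by positivity), ?_⟩
  set K := max (1 / T (2*X)) (q / (1 - q))
  have hK1 : 1 ≤ K * T (2 * X) := by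
    rw [← div_le_iff₀ h2X]; exact le_max_left _ _
  have hK2 : q ≤ K * (1 - q) := by
    rw [← div_le_iff₀ (by linarith)]; exact le_max_right _ _
  have key : ∀ n : ℕ, ∀ x, X ≤ x → x ≤ 2 ^ (n+1) * X → G x ≤ K * (x * T x) := by
    intro n
    induction n with
    | zero =>
      intro x hx hx2
      have h1 := hTanti (show x ≤ 2 * X by simpa using hx2)
      have hx0 : 0 < x := by linarith
      have hK : 0 < K := lt_max_of_lt_left (by positivity)
      have : 1 ≤ K * T x := hK1.trans (by gcongr)
      nlinarith [hG x hx0.le]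
    | succ n ih =>
      intro x hx hx2
      rcases le_total x (2 * X) with h | h
      · exact ih x hx (h.trans (by
          gcongr
          exact le_self_pow₀ (by norm_num) (by omega)))
      · have hy : X ≤ x / 2 := by linarith
        have h1 := ih (x/2) hy (by rw [pow_succ] at hx2; linarith)
        have h2 := hstep (x/2) (by linarith)
        have h3 := hd (x/2) hy
        rw [show 2 * (x/2) = x by ring] at h2 h3
        have hTx := hTpos x (by linarith)
        have hK : 0 < K := lt_max_of_lt_left (by positivity)
        have hx0 : 0 < x := by linarith
        calc G x ≤ (K + 1) * (x / 2) * T (x/2) := by linarith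
          _ ≤ (K + 1) * (x/2) * (2 * q * T x) := by gcongr
          _ = (K * q + q) * (x * T x) := by ring
          _ ≤ K * (x * T x) := by
            gcongr
            linarith
  intro x hx
  obtain ⟨n, hn⟩ := pow_unbounded_of_one_lt (x / X) (one_lt_two)
  refine key n x hx ?_
  rw [div_lt_iff₀ hX] at hn
  refine hn.le.trans ?_
  gcongr
  · norm_num
  · omega

lemma core {Y : Type*} [MeasurableSpace Y] (μ : Measure Y) [IsProbabilityMeasure μ]
    (φ : Y → ℕ) (hφ : Measurable φ) (z : ℂ) (hz : ‖z‖ ≤ 1) (V : Y → ℂ) (hV : Measurable V)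
    (hV1 : ∫ y, V y ∂μ = 1) (δ : ℝ) (hδ : ∀ y, ‖V y - 1‖ ≤ δ) :
    Integrable (fun y => (1 - z ^ φ y).re) μ ∧ Integrable (fun y => ‖1 - z ^ φ y‖) μ ∧
    ∫ y, (1 - z ^ φ y).re ∂μ - δ * ∫ y, ‖1 - z ^ φ y‖ ∂μ ≤ ‖1 - ∫ y, z ^ φ y * V y ∂μ‖ := by
  have hzm : Measurable fun y => z ^ φ y := (measurable_of_countable (fun n : ℕ => z ^ n)).comp hφ
  have hzb : ∀ y, ‖z ^ φ y‖ ≤ 1 := fun y => by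
    rw [norm_pow]; exact pow_le_one₀ (norm_nonneg _) hz
  have hVi : Integrable V μ := by
    by_contra h
    rw [integral_undef h] at hV1
    exact zero_ne_one hV1
  have hzi : Integrable (fun y => z ^ φ y) μ :=
    Integrable.of_bound hzm.aestronglyMeasurable 1 (Eventually.of_forall hzb)
  have hi : Integrable (fun y => 1 - z ^ φ y) μ := (integrable_const 1).sub hzi
  have hzV : Integrable (fun y => z ^ φ y * V y) μ :=
    hVi.bdd_mul hzm.aestronglyMeasurable (Eventually.of_forall hzb)
  have he : Integrable (fun y => (1 - z ^ φ y) * (V y - 1)) μ := by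
    refine hi.mul_bdd (c := δ) (hV.sub_const 1).aestronglyMeasurable (Eventually.of_forall hδ)
  refine ⟨hi.re, hi.norm, ?_⟩
  have h1 : 1 - ∫ y, z ^ φ y * V y ∂μ = ∫ y, (1 - z ^ φ y) ∂μ + ∫ y, (1 - z ^ φ y) * (V y - 1) ∂μ := by
    rw [← integral_add hi he]
    nth_rewrite 1 [← hV1]
    rw [← integral_sub hVi hzV]
    congr 1; ext y; ring
  have h2 : ‖∫ y, (1 - z ^ φ y) * (V y - 1) ∂μ‖ ≤ δ * ∫ y, ‖1 - z ^ φ y‖ ∂μ := by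
    refine (norm_integral_le_integral_norm _).trans ?_
    rw [← integral_const_mul]
    refine integral_mono he.norm (hi.norm.const_mul δ) fun y => ?_
    simp only [norm_mul]
    rw [mul_comm]
    gcongr
    exact hδ y
  have h3 : ∫ y, (1 - z ^ φ y).re ∂μ ≤ ‖∫ y, (1 - z ^ φ y) ∂μ‖ := by
    have : ∫ y, (1 - z ^ φ y).re ∂μ = (∫ y, (1 - z ^ φ y) ∂μ).re := integral_re hi
    rw [this]; exact Complex.re_le_norm _
  have h4 := norm_sub_le_norm_add (∫ y, (1 - z ^ φ y) ∂μ) (∫ y, (1 - z ^ φ y) * (V y - 1) ∂μ)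
  rw [h1]
  linarith

lemma pow_bound (z : ℂ) (hz : ‖z‖ ≤ 1) (n : ℕ) : ‖1 - z ^ n‖ ≤ n * ‖1 - z‖ := by
  induction n with
  | zero => simp
  | succ n ih =>
    have : 1 - z ^ (n+1) = (1 - z ^ n) + z ^ n * (1 - z) := by ring
    rw [this]
    refine (norm_add_le _ _).trans ?_
    have h : ‖z ^ n * (1 - z)‖ ≤ 1 * ‖1 - z‖ := by
      rw [norm_mul, norm_pow]
      gcongr
      exact pow_le_one₀ (norm_nonneg _) hz
    push_cast
    linarith

lemma pow_bound2 (z : ℂ) (hz : ‖z‖ ≤ 1) (n : ℕ) (m : ℝ) (hm : ‖1 - z‖ ≤ 4 * m) :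
    ‖1 - z ^ n‖ ≤ 4 * min 1 (m * n) := by
  have h1 := pow_bound z hz n
  have h2 : ‖1 - z ^ n‖ ≤ 2 := by
    refine (norm_sub_le _ _).trans ?_
    rw [norm_pow, norm_one]
    linarith [pow_le_one₀ (norm_nonneg z) hz (n := n)]
  rcases min_cases (1:ℝ) (m * n) with h | h <;> rw [h.1]
  · linarith
  · have : (n:ℝ) * ‖1 - z‖ ≤ n * (4 * m) := by gcongr
    linarith

lemma re_pow (u θ : ℝ) (n : ℕ) :
    (1 - (Complex.exp (-(u : ℂ) + Complex.I * θ)) ^ n).re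
      = 1 - Real.exp (-(u * n)) * Real.cos (θ * n) := by
  rw [← Complex.exp_nat_mul, Complex.sub_re, Complex.exp_re]
  simp
  ring_nf

lemma exp_lower (t : ℝ) (ht : 0 ≤ t) : (1/2) * min 1 t ≤ 1 - Real.exp (-t) := by
  have h1 : Real.exp (-t) ≤ 1 / (1 + t) := by
    rw [Real.exp_neg, ← one_div]
    apply one_div_le_one_div_of_le (by linarith)
    linarith [Real.add_one_le_exp t]
  have h2 : (1/2) * min 1 t ≤ 1 - 1 / (1 + t) := by
    have : 1 - 1 / (1 + t) = t / (1 + t) := by field_simp; ring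
    rw [this, le_div_iff₀ (by linarith)]
    rcases min_cases (1:ℝ) t with h | h <;> rw [h.1]
    · linarith
    · nlinarith
  linarith

set_option maxHeartbeats 2000000

theorem lower_bound_one_sub_lambda
    {Y : Type*} [MeasurableSpace Y] (μ : Measure Y) [IsProbabilityMeasure μ]
    (φ : Y → ℕ) (hφmeas : Measurable φ) (hφpos : ∀ y, 1 ≤ φ y)
    (l : ℝ → ℝ) (hl : SlowlyVarying l) (β : ℝ) (hβ1 : 0 < β) (hβ2 : β < 1)
    (htail : ∀ n : ℕ, 1 ≤ n → (μ {y | n < φ y}).toReal = l n * (n : ℝ) ^ (-β))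
    (r₀ : ℝ) (hr₀ : 0 < r₀)
    (v : ℂ → Y → ℂ)
    (hv_meas : ∀ z : ℂ, ‖z‖ ≤ 1 → z ≠ 1 → ‖z - 1‖ < r₀ →
      Measurable (v z) ∧ (∫ y, v z y ∂μ) = 1)
    (hv_lim : ∀ δ : ℝ, 0 < δ → ∃ r : ℝ, 0 < r ∧
      ∀ z : ℂ, ‖z‖ ≤ 1 → z ≠ 1 → ‖z - 1‖ < r → ∀ y, ‖v z y - 1‖ ≤ δ) :
    ∃ ε C : ℝ, 0 < ε ∧ 0 < C ∧ ∀ u : ℝ, 0 ≤ u → u < ε → ∀ θ : ℝ, 0 < θ → θ < ε →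
      C * l (1 / θ) * θ ^ β
        ≤ ‖1 - ∫ y, (Complex.exp (-(u : ℂ) + Complex.I * θ)) ^ (φ y)
              * v (Complex.exp (-(u : ℂ) + Complex.I * θ)) y ∂μ‖ := by
  let S : ℝ → Set Y := fun x => {y | x < (φ y : ℝ)}
  let T : ℝ → ℝ := fun x => μ.real (S x)
  have hφR : Measurable fun y => (φ y : ℝ) := measurable_from_nat.comp hφmeas
  have hSm : ∀ x, MeasurableSet (S x) := fun x => measurableSet_lt measurable_const hφR
  have hT : ∀ x, 1 ≤ x → T x = l (⌊x⌋₊ : ℝ) * (⌊x⌋₊ : ℝ) ^ (-β) := by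
    intro x hx
    rw [← htail _ (Nat.floor_pos.2 hx)]
    simp only [T, S, Measure.real]
    congr 2
    ext y
    simp [Nat.floor_lt (show 0 ≤ x by linarith)]
  have hTanti : Antitone T := fun a b hab =>
    measureReal_mono (fun y hy => lt_of_le_of_lt hab hy)
  have hTpos : ∀ x, 0 < x → 0 < T x := by
    intro x hx
    refine lt_of_lt_of_le ?_ (hTanti (show x ≤ x + 1 by linarith))
    rw [hT _ (by linarith)]
    have : (0:ℝ) < ⌊x+1⌋₊ := by exact_mod_cast Nat.floor_pos.2 (by linarith)
    have := SV_pos hl this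
    positivity
  let G : ℝ → ℝ := fun x => ∫ y, min x (φ y : ℝ) ∂μ
  have hGi : ∀ x, 0 ≤ x → Integrable (fun y => min x (φ y : ℝ)) μ := by
    intro x hx
    refine Integrable.of_bound (measurable_const.min hφR).aestronglyMeasurable x
      (Eventually.of_forall fun y => ?_)
    rw [Real.norm_of_nonneg (le_min hx (Nat.cast_nonneg _))]
    exact min_le_left _ _
  have hSi : ∀ x, Integrable ((S x).indicator (fun _ => (1:ℝ))) μ := fun x =>
    (integrable_const 1).indicator (hSm x)
  have hSint : ∀ x, ∫ y, (S x).indicator (fun _ => (1:ℝ)) y ∂μ = T x := by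
    intro x
    exact integral_indicator_one (hSm x)
  have hG1 : ∀ x, 0 ≤ x → G x ≤ x := by
    intro x hx
    calc G x ≤ ∫ y, x ∂μ := integral_mono (hGi x hx) (integrable_const _) fun y => min_le_left _ _
      _ = x := by simp
  have hstep : ∀ x, 0 ≤ x → G (2 * x) ≤ G x + x * T x := by
    intro x hx
    rw [← hSint, ← integral_const_mul, ← integral_add (hGi x hx) ((hSi x).const_mul x)]
    refine integral_mono (hGi _ (by linarith)) ((hGi x hx).add ((hSi x).const_mul x)) fun y => ?_
    by_cases hy : y ∈ S x
    · have : x < (φ y : ℝ) := hy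
      simp only [Set.indicator_of_mem hy, min_eq_left this.le]
      linarith [min_le_left (2*x) (φ y : ℝ)]
    · have : (φ y : ℝ) ≤ x := not_lt.1 hy
      simp only [Set.indicator_of_notMem hy, min_eq_right this]
      linarith [min_le_right (2*x) (φ y : ℝ)]
  -- doubling
  obtain ⟨K, X, hK, hX, hkar⟩ : ∃ K X, 0 < K ∧ 0 < X ∧ ∀ x, X ≤ x → G x ≤ K * (x * T x) := by
    have h2 : (1/2 : ℝ) < 2 ^ (-β) := by
      have : (2:ℝ) ^ (-1:ℝ) < 2 ^ (-β) := Real.rpow_lt_rpow_of_exponent_lt (by norm_num) (by linarith)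
      rw [Real.rpow_neg_one] at this
      linarith
    obtain ⟨p, hp1, hp2⟩ := exists_between h2
    have hev := (T_ratio hl β hT 2 (by norm_num)).eventually (lt_mem_nhds hp2)
    obtain ⟨X, hX⟩ := eventually_atTop.1 hev
    obtain ⟨K, hK, h⟩ := karamata G T hTpos hTanti hG1 hstep (1 / (2 * p)) (max X 1) (by positivity)
      (by rw [div_lt_one (by linarith)]; linarith) (by positivity) (by
        intro x hx
        have h1 := hX x ((le_max_left _ _).trans hx)
        have hx1 : 1 ≤ x := (le_max_right _ _).trans hx
        rw [lt_div_iff₀ (hTpos x (by linarith))] at h1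
        have hp : 0 < p := by linarith
        have : 2 * (1 / (2 * p)) * T (2 * x) = T (2 * x) / p := by field_simp
        rw [this, le_div_iff₀ hp]
        linarith)
    exact ⟨K, max X 1, hK, by positivity, h⟩
  -- ratio three
  obtain ⟨p, hp1, X3, hX3⟩ : ∃ p, p < 1 ∧ ∃ X3, ∀ x, X3 ≤ x → T (3 * x) ≤ p * T x := by
    have h3 : (3 : ℝ) ^ (-β) < 1 := Real.rpow_lt_one_of_one_lt_of_neg (by norm_num) (by linarith)
    obtain ⟨p, hp1, hp2⟩ := exists_between h3
    have hev := (T_ratio hl β hT 3 (by norm_num)).eventually (gt_mem_nhds hp1)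
    obtain ⟨X, hX⟩ := eventually_atTop.1 hev
    refine ⟨p, hp2, max X 1, fun x hx => ?_⟩
    have hx1 : 1 ≤ x := (le_max_right _ _).trans hx
    have h1 := hX x ((le_max_left _ _).trans hx)
    rw [div_lt_iff₀ (hTpos x (by linarith))] at h1
    exact h1.le
  obtain ⟨ρ, hρ, X4, hX4⟩ : ∃ ρ, 0 < ρ ∧ ∃ X4, ∀ x, X4 ≤ x → ρ * T x ≤ T (Real.pi / 2 * x) := by
    have h3 : (0:ℝ) < (Real.pi / 2) ^ (-β) := by positivity
    obtain ⟨p, hp1, hp2⟩ := exists_between h3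
    have hev := (T_ratio hl β hT (Real.pi/2) (by positivity)).eventually (lt_mem_nhds hp2)
    obtain ⟨X, hX⟩ := eventually_atTop.1 hev
    refine ⟨p, hp1, max X 1, fun x hx => ?_⟩
    have hx1 : 1 ≤ x := (le_max_right _ _).trans hx
    have h1 := hX x ((le_max_left _ _).trans hx)
    rw [lt_div_iff₀ (hTpos x (by linarith))] at h1
    exact h1.le
  obtain ⟨X5, hX5⟩ : ∃ X5, ∀ x, X5 ≤ x → (1/2) * (l x * x ^ (-β)) ≤ T x := by
    have hev := (T_asymp hl β hT).eventually (lt_mem_nhds (show (1/2:ℝ) < 1 by norm_num))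
    obtain ⟨X, hX⟩ := eventually_atTop.1 hev
    refine ⟨max X 1, fun x hx => ?_⟩
    have hx1 : 1 ≤ x := (le_max_right _ _).trans hx
    have h1 := hX x ((le_max_left _ _).trans hx)
    have := SV_pos hl (show 0 < x by linarith)
    rw [lt_div_iff₀ (by positivity)] at h1
    exact h1.le
  set δ := min (1/16) ((1 - p) / (16 * K)) with hδdef
  have hδ0 : 0 < δ := lt_min (by norm_num) (div_pos (by linarith) (by linarith))
  have hδ1 : δ ≤ 1/16 := min_le_left _ _
  have hδ2 : δ * (16 * K) ≤ 1 - p := by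
    rw [← le_div_iff₀ (by positivity)]; exact min_le_right _ _
  obtain ⟨r, hr, hvr⟩ := hv_lim δ hδ0
  set M := max (max X X3) (max (max X4 X5) 1) with hM
  have hM1 : 1 ≤ M := (le_max_right _ _).trans (le_max_right _ _)
  have hMX : X ≤ M := (le_max_left _ _).trans (le_max_left _ _)
  have hMX3 : X3 ≤ M := (le_max_right _ _).trans (le_max_left _ _)
  have hMX4 : X4 ≤ M := (le_max_left _ _).trans ((le_max_left _ _).trans (le_max_right _ _))
  have hMX5 : X5 ≤ M := (le_max_right _ _).trans ((le_max_left _ _).trans (le_max_right _ _))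
  set ε := min (min (1/2) (1/M)) (min (r/4) (r₀/4)) with hε
  have hε0 : 0 < ε := by positivity
  have hε1 : ε ≤ 1/2 := (min_le_left _ _).trans (min_le_left _ _)
  have hε2 : ε ≤ 1/M := (min_le_left _ _).trans (min_le_right _ _)
  have hε3 : ε ≤ r/4 := (min_le_right _ _).trans (min_le_left _ _)
  have hε4 : ε ≤ r₀/4 := (min_le_right _ _).trans (min_le_right _ _)
  set D := min (1/4) ((1 - p) / 2 * ρ) with hD
  have hD0 : 0 < D := lt_min (by norm_num) (mul_pos (by linarith) hρ)
  refine ⟨ε, D / 2, hε0, by positivity, fun u hu0 hu θ hθ0 hθ => ?_⟩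
  set z := Complex.exp (-(u : ℂ) + Complex.I * θ) with hz
  set w : ℂ := -(u : ℂ) + Complex.I * θ with hw
  have hz1 : ‖z‖ ≤ 1 := by
    rw [hz, Complex.norm_exp]
    simpa [hw] using hu0
  have hzne : z ≠ 1 := by
    intro h
    have h1 : z.im = 0 := by rw [h]; simp
    rw [hz, Complex.exp_im] at h1
    have : w.im = θ := by simp [hw]
    rw [this] at h1
    have h2 := Real.sin_pos_of_pos_of_lt_pi hθ0 (by linarith [Real.pi_gt_three])
    have h3 := Real.exp_pos w.re
    exact (mul_pos h3 h2).ne' h1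
  have hwn : ‖w‖ ≤ u + θ := by
    refine (norm_add_le _ _).trans ?_
    simp [abs_of_nonneg hu0, abs_of_pos hθ0]
  have hz2 : ‖1 - z‖ ≤ 2 * (u + θ) := by
    rw [norm_sub_rev]
    exact (Complex.norm_exp_sub_one_le (by linarith)).trans (by linarith)
  have hz3 : ‖z - 1‖ ≤ 2 * (u + θ) := by rw [norm_sub_rev]; exact hz2
  obtain ⟨hVm, hV1⟩ := hv_meas z hz1 hzne (by linarith)
  have hVδ := hvr z hz1 hzne (by linarith)
  obtain ⟨hi1, hi2, hcore⟩ := core μ φ hφmeas z hz1 (v z) hVm hV1 δ hVδ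
  have hx : M ≤ 1 / θ := by
    rw [le_div_iff₀ hθ0]
    have : θ ≤ 1 / M := by linarith
    rw [le_div_iff₀ (by linarith)] at this
    linarith
  have hfin : l (1/θ) * θ ^ β ≤ 2 * T (1/θ) := by
    have := hX5 (1/θ) (hMX5.trans hx)
    have h2 : (1/θ) ^ (-β) = θ ^ β := by
      rw [one_div, Real.inv_rpow hθ0.le, Real.rpow_neg hθ0.le, inv_inv]
    rw [h2] at this
    linarith
  have hTx : 0 < T (1/θ) := hTpos _ (by positivity)
  suffices hs : D * T (1/θ) ≤ ‖1 - ∫ y, z ^ (φ y) * v z y ∂μ‖ by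
    refine le_trans ?_ hs
    calc D / 2 * l (1/θ) * θ ^ β = D / 2 * (l (1/θ) * θ ^ β) := by ring
      _ ≤ D / 2 * (2 * T (1/θ)) := by gcongr
      _ = _ := by ring
  refine le_trans ?_ hcore
  rcases le_or_gt u θ with hc | hc
  · -- case u ≤ θ
    set a := Real.pi / 2 * (1/θ) with ha
    have hpi := Real.pi_gt_three
    have hpi4 := Real.pi_le_four
    have haθ : 1/θ ≤ a := by
      rw [ha]
      have : 0 < 1/θ := by positivity
      nlinarith
    have hθa : θ * a = Real.pi / 2 := by rw [ha]; field_simp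
    have ha0 : 0 < a := by positivity
    have hTa := hTpos a ha0
    have hA : T a - T (3 * a) ≤ ∫ y, (1 - z ^ φ y).re ∂μ := by
      rw [← hSint, ← hSint, ← integral_sub (hSi _) (hSi _)]
      refine integral_mono ((hSi _).sub (hSi _)) hi1 fun y => ?_
      show _ ≤ (1 - z ^ φ y).re
      rw [hz, hw, re_pow]
      have he1 : Real.exp (-(u * φ y)) ≤ 1 := Real.exp_le_one_iff.2 (by
        have : 0 ≤ u * φ y := by positivity
        linarith)
      have he0 := Real.exp_pos (-(u * φ y))
      have hcos := Real.cos_le_one (θ * φ y)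
      have hge0 : 0 ≤ 1 - Real.exp (-(u * φ y)) * Real.cos (θ * φ y) := by nlinarith
      by_cases h1 : y ∈ S a
      · by_cases h3 : y ∈ S (3 * a)
        · simpa [Set.indicator_of_mem h1, Set.indicator_of_mem h3] using hge0
        · simp only [Set.indicator_of_mem h1, Set.indicator_of_notMem h3]
          have h1' : a < (φ y : ℝ) := h1
          have h3' : (φ y : ℝ) ≤ 3 * a := not_lt.1 h3
          have : Real.cos (θ * φ y) ≤ 0 := by
            apply Real.cos_nonpos_of_pi_div_two_le_of_le
            · rw [← hθa]; gcongr
            · have : θ * φ y ≤ θ * (3 * a) := by gcongr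
              linarith
          nlinarith
      · have h3 : y ∉ S (3 * a) := fun h => h1 (lt_trans (show a < 3 * a by linarith) h)
        simpa [Set.indicator_of_notMem h1, Set.indicator_of_notMem h3] using hge0
    have hB : ∫ y, ‖1 - z ^ φ y‖ ∂μ ≤ 8 / a * G a := by
      rw [← integral_const_mul]
      refine integral_mono hi2 ((hGi a ha0.le).const_mul _) fun y => ?_
      refine (pow_bound2 z hz1 (φ y) θ (by linarith)).trans ?_
      have : min 1 (θ * φ y) ≤ 2 / a * min a (φ y) := by
        rw [mul_min_of_nonneg _ _ (by positivity)]
        apply min_le_min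
        · rw [div_mul_cancel₀ _ ha0.ne']; norm_num
        · gcongr
          rw [le_div_iff₀ ha0, hθa]; linarith
      calc 4 * min 1 (θ * φ y) ≤ 4 * (2 / a * min a (φ y)) := by gcongr
        _ = _ := by ring
    have hGa := hkar a (hMX.trans (hx.trans haθ))
    have h3a := hX3 a (hMX3.trans (hx.trans haθ))
    have h4a := hX4 (1/θ) (hMX4.trans hx)
    have hB2 : ∫ y, ‖1 - z ^ φ y‖ ∂μ ≤ 8 * K * T a := by
      refine hB.trans ?_
      calc 8 / a * G a ≤ 8 / a * (K * (a * T a)) := by gcongr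
        _ = _ := by field_simp
    have hB3 : δ * ∫ y, ‖1 - z ^ φ y‖ ∂μ ≤ (1 - p) / 2 * T a := by
      calc _ ≤ δ * (8 * K * T a) := by gcongr
        _ = (δ * (16 * K)) / 2 * T a := by ring
        _ ≤ _ := by gcongr
    have hDT : D * T (1/θ) ≤ (1 - p) / 2 * T a := by
      calc D * T (1/θ) ≤ (1 - p) / 2 * ρ * T (1/θ) := by gcongr; exact min_le_right _ _
        _ = (1 - p) / 2 * (ρ * T (1/θ)) := by ring
        _ ≤ _ := by
          apply mul_le_mul_of_nonneg_left h4a; linarith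
    linarith
  · -- case θ < u
    have hu1 : 0 < u := by linarith
    have hmi : Integrable (fun y => min 1 (u * φ y)) μ := by
      refine Integrable.of_bound (measurable_const.min (hφR.const_mul u)).aestronglyMeasurable 1
        (Eventually.of_forall fun y => ?_)
      rw [Real.norm_of_nonneg (le_min zero_le_one (by positivity))]
      exact min_le_left _ _
    have hA : (1/2) * ∫ y, min 1 (u * φ y) ∂μ ≤ ∫ y, (1 - z ^ φ y).re ∂μ := by
      rw [← integral_const_mul]
      refine integral_mono (hmi.const_mul _) hi1 fun y => ?_
      show _ ≤ (1 - z ^ φ y).re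
      rw [hz, hw, re_pow]
      refine (exp_lower (u * φ y) (by positivity)).trans ?_
      have he0 := Real.exp_pos (-(u * φ y))
      have hcos := Real.cos_le_one (θ * φ y)
      nlinarith
    have hB : ∫ y, ‖1 - z ^ φ y‖ ∂μ ≤ 4 * ∫ y, min 1 (u * φ y) ∂μ := by
      rw [← integral_const_mul]
      refine integral_mono hi2 (hmi.const_mul _) fun y => ?_
      exact pow_bound2 z hz1 (φ y) u (by linarith)
    have hC : T (1/θ) ≤ ∫ y, min 1 (u * φ y) ∂μ := by
      rw [← hSint]
      refine integral_mono (hSi _) hmi fun y => ?_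
      by_cases hy : y ∈ S (1/θ)
      · have h1 : 1/θ < (φ y : ℝ) := hy
        simp only [Set.indicator_of_mem hy]
        apply le_min le_rfl
        rw [div_lt_iff₀ hθ0] at h1
        have : (φ y : ℝ) * θ ≤ φ y * u := by gcongr
        linarith
      · simp only [Set.indicator_of_notMem hy]
        exact le_min zero_le_one (by positivity)
    have hB2 : δ * ∫ y, ‖1 - z ^ φ y‖ ∂μ ≤ 1/16 * (4 * ∫ y, min 1 (u * φ y) ∂μ) := by
      have : 0 ≤ ∫ y, ‖1 - z ^ φ y‖ ∂μ := integral_nonneg fun y => norm_nonneg _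
      gcongr
    have hDT : D * T (1/θ) ≤ 1/4 * T (1/θ) := by gcongr; exact min_le_left _ _
    linarith
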